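/- Let X^(1), …, X^(l) be d-dimensional real tensors, each of size n_1 × ⋯ × n_d, and suppose each X^(k) admits a tensor-train representation with ranks r_0^(k), r_1^(k), …, r_d^(k) (r_0^(k) = r_d^(k) = 1). Then the stacked (d+1)-dimensional tensor X of size n_1 × ⋯ × n_d × l, defined by X(i_1,…,i_d,k) = X^(k)(i_1,…,i_d), admits a tensor-train representation with ranks R_0 = R_{d+1} = 1, R_s = Σ_{k=1}^{l} r_s^(k) for 1 ≤ s ≤ d − 1, and R_d = l. -/

import Mathlib

/-- `isTT r X` says that the `d`-dimensional tensor `X` of size `n 0 × ⋯ × n (d-1)` admits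
a tensor-train representation with ranks `r 0, r 1, …, r d`, i.e. there are cores
`G k ∈ ℝ^{r k × n k × r (k+1)}` with
`X(i) = Σ_{α} G 0 (α 0) (i 0) (α 1) ⋯ G (d-1) (α (d-1)) (i (d-1)) (α d)`,
and the boundary ranks satisfy `r 0 = r d = 1`. -/
def isTT {d : ℕ} {n : Fin d → ℕ} (r : Fin (d + 1) → ℕ)
    (X : ((k : Fin d) → Fin (n k)) → ℝ) : Prop :=
  r 0 = 1 ∧ r (Fin.last d) = 1 ∧
    ∃ G : (k : Fin d) → (Fin (r k.castSucc) → Fin (n k) → Fin (r k.succ) → ℝ),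
      ∀ i, X i = ∑ α : ((k : Fin (d + 1)) → Fin (r k)),
        ∏ k : Fin d, G k (α k.castSucc) (i k) (α k.succ)

/-- The multi-index of the stacked `(d+1)`-dimensional tensor of size
`n 0 × ⋯ × n (d-1) × l` corresponding to the multi-index `t` in the first `d`
dimensions and index `k` in the last dimension. -/
def sidx {d : ℕ} {n : Fin d → ℕ} {l : ℕ} (t : (j : Fin d) → Fin (n j)) (k : Fin l) :
    (j : Fin (d + 1)) → Fin (Fin.snoc (α := fun _ => ℕ) n l j) :=
  Fin.snoc (α := fun j => Fin (Fin.snoc (α := fun _ => ℕ) n l j))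
    (fun j' => Fin.cast (Fin.snoc_castSucc (α := fun _ => ℕ) l n j').symm (t j'))
    (Fin.cast (Fin.snoc_last (α := fun _ => ℕ) l n).symm k)

open Finset in
/-- A sum over multi-indices may be reindexed along enumerations of finite label sets. -/
theorem sum_pi_fin_eq_sum_piFinset {ι γ M : Type*} [Fintype ι] [DecidableEq ι] [AddCommMonoid M]
    {R : ι → ℕ} (S : ι → Finset γ) (e : ∀ s, Fin (R s) ≃ S s) (F : (ι → γ) → M) :
    ∑ α : (s : ι) → Fin (R s), F (fun s => (e s (α s)).1) = ∑ p ∈ Fintype.piFinset S, F p := by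
  refine Finset.sum_bij (fun α _ s => (e s (α s)).1) ?_ ?_ ?_ ?_
  · intro α _
    exact Fintype.mem_piFinset.2 fun s => (e s (α s)).2
  · intro α _ β _ h
    funext s
    exact (e s).injective (Subtype.ext (congrFun h s))
  · intro p hp
    rw [Fintype.mem_piFinset] at hp
    exact ⟨fun s => (e s).symm ⟨p s, hp s⟩, mem_univ _, by simp⟩
  · intros
    rfl

open Finset in
/-- A TT representation whose rank indices are labelled by arbitrary finite sets. -/
theorem isTT_of_piFinset {γ : Type*} {d : ℕ} {n : Fin d → ℕ} {r : Fin (d + 1) → ℕ}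
    {X : ((k : Fin d) → Fin (n k)) → ℝ} (h0 : r 0 = 1) (hlast : r (Fin.last d) = 1)
    (S : Fin (d + 1) → Finset γ) (hS : ∀ s, #(S s) = r s) (H : ℕ → γ → ℕ → γ → ℝ)
    (hX : ∀ i, X i = ∑ p ∈ Fintype.piFinset S,
      ∏ k : Fin d, H k (p k.castSucc) (i k) (p k.succ)) : isTT r X := by
  let e : ∀ s, Fin (r s) ≃ S s := fun s => ((S s).equivFinOfCardEq (hS s)).symm
  refine ⟨h0, hlast, fun k a x b => H k (e _ a).1 x (e _ b).1, fun i => ?_⟩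
  rw [hX]
  exact (sum_pi_fin_eq_sum_piFinset S e
    fun p => ∏ k : Fin d, H k (p k.castSucc) (i k) (p k.succ)).symm

open Finset in
/-- The cores of a TT representation may be extended to all natural indices. -/
theorem isTT.exists_nat_cores {d : ℕ} {n : Fin d → ℕ} {r : Fin (d + 1) → ℕ}
    {X : ((k : Fin d) → Fin (n k)) → ℝ} (h : isTT r X) :
    ∃ g : ℕ → ℕ → ℕ → ℕ → ℝ, ∀ i, X i = ∑ p ∈ Fintype.piFinset fun s => range (r s),
      ∏ k : Fin d, g k (p k.castSucc) (i k) (p k.succ) := by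
  obtain ⟨-, -, G, hG⟩ := h
  refine ⟨fun k a x b => if hk : k < d then
    if hh : a < r (Fin.castSucc ⟨k, hk⟩) ∧ x < n ⟨k, hk⟩ ∧ b < r (Fin.succ ⟨k, hk⟩) then
      G ⟨k, hk⟩ ⟨a, hh.1⟩ ⟨x, hh.2.1⟩ ⟨b, hh.2.2⟩ else 0 else 0, fun i => ?_⟩
  rw [hG, ← sum_pi_fin_eq_sum_piFinset (fun s => range (r s))
    fun s => Fin.equivSubtype.trans (Equiv.subtypeEquivRight fun _ => mem_range.symm)]
  refine sum_congr rfl fun α _ => prod_congr rfl fun k _ => ?_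
  simp [Fin.equivSubtype]

/-- The core of the stacked tensor: block diagonal in the interior, a row of blocks at the first
position, and the slice selector at position `d`. A rank label `⟨k, a⟩` is the index `a` of the
`k`-th slice. -/
def stackCore (d : ℕ) (g : ℕ → ℕ → ℕ → ℕ → ℕ → ℝ) (j : ℕ) (a : Σ _ : ℕ, ℕ) (x : ℕ)
    (b : Σ _ : ℕ, ℕ) : ℝ :=
  if j = d then if a.1 = x then 1 else 0
  else if j = 0 then g b.1 0 0 x b.2
  else if a.1 = b.1 then g b.1 j a.2 x b.2 else 0

/-- The rank labels of the stacked tensor. -/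
def stackLabels (d l : ℕ) (ρ : ℕ → ℕ → ℕ) (s : ℕ) : Finset (Σ _ : ℕ, ℕ) :=
  if s = 0 ∨ s = d + 1 then {⟨0, 0⟩} else (Finset.range l).sigma fun k => Finset.range (ρ k s)

open Finset in
/-- Contracting the stacked cores with last index `k` gives the contraction of the cores of the
`k`-th slice. -/
theorem sum_prod_stackCore {d l k : ℕ} (hd : 1 ≤ d) (hk : k < l) (ρ : ℕ → ℕ → ℕ)
    (h0 : ρ k 0 = 1) (g : ℕ → ℕ → ℕ → ℕ → ℕ → ℝ) (x : ℕ → ℕ) (hx : x d = k) :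
    ∑ β ∈ Fintype.piFinset fun s : Fin (d + 1) => range (ρ k s),
        ∏ j : Fin d, g k j (β j.castSucc) (x j) (β j.succ) =
      ∑ p ∈ Fintype.piFinset fun s : Fin (d + 2) => stackLabels d l ρ s,
        ∏ j : Fin (d + 1), stackCore d g j (p j.castSucc) (x j) (p j.succ) := by
  let E : (Fin (d + 1) → ℕ) → Fin (d + 2) → Σ _ : ℕ, ℕ := fun β s =>
    if h : s.1 = 0 ∨ s.1 = d + 1 then ⟨0, 0⟩ else ⟨k, β ⟨s.1, by omega⟩⟩
  have hE0 : ∀ β s, (s.1 = 0 ∨ s.1 = d + 1) → E β s = ⟨0, 0⟩ := fun β s h => dif_pos h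
  have hE : ∀ β (s : Fin (d + 2)) (h : s.1 ≠ 0) (h' : s.1 < d + 1),
      E β s = ⟨k, β ⟨s.1, h'⟩⟩ := fun β s h h' => dif_neg (by omega)
  have hzero : ∀ β ∈ Fintype.piFinset fun s : Fin (d + 1) => range (ρ k s), β 0 = 0 := by
    intro β hβ
    have := Fintype.mem_piFinset.1 hβ 0
    simpa [h0] using this
  refine sum_of_injOn E ?_ ?_ ?_ ?_
  · intro β hβ β' hβ' h
    funext s
    by_cases hs : s = 0
    · rw [hs, hzero β hβ, hzero β' hβ']
    · have h1 := congrFun h s.castSucc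
      have hs' : s.1 ≠ 0 := fun h => hs (Fin.ext h)
      rw [hE β _ hs' s.2, hE β' _ hs' s.2] at h1
      simpa using h1
  · intro β hβ
    have hβ := Fintype.mem_piFinset.1 (mem_coe.1 hβ)
    refine mem_coe.2 (Fintype.mem_piFinset.2 fun s => ?_)
    by_cases hs : s.1 = 0 ∨ s.1 = d + 1
    · rw [hE0 β s hs, stackLabels, if_pos hs]
      exact mem_singleton_self _
    · rw [hE β s (by omega) (by omega), stackLabels, if_neg hs]
      exact mem_sigma.2 ⟨mem_range.2 hk, hβ ⟨s.1, by omega⟩⟩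
  · intro p hp hpE
    by_contra hne
    have hne := fun j => (prod_ne_zero_iff.1 hne) j (mem_univ j)
    have hp := Fintype.mem_piFinset.1 hp
    have hlab : ∀ m (hm : m < d), (p ⟨d - m, by omega⟩).1 = k := by
      intro m
      induction m with
      | zero =>
        intro _
        by_contra hc
        refine hne (Fin.last d) ?_
        rw [stackCore, if_pos (Fin.val_last d), if_neg]
        rw [Fin.val_last, hx]
        exact hc
      | succ m ih =>
        intro hm
        rw [← ih (by omega)]
        by_contra hc
        refine hne ⟨d - (m + 1), by omega⟩ ?_
        rw [stackCore, if_neg (by simp only; omega), if_neg (by simp only; omega), if_neg]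
        have hsucc : Fin.succ ⟨d - (m + 1), by omega⟩ = (⟨d - m, by omega⟩ : Fin (d + 2)) :=
          Fin.ext (by simp only [Fin.succ_mk]; omega)
        rw [hsucc]
        exact hc
    have hlab' : ∀ s : Fin (d + 2), s.1 ≠ 0 → s.1 ≠ d + 1 → (p s).1 = k := by
      intro s hs hs'
      rw [← hlab (d - s.1) (by omega)]
      congr 2
      exact Fin.ext (Nat.sub_sub_self (by omega)).symm
    let β : Fin (d + 1) → ℕ := fun s => if s = 0 then 0 else (p s.castSucc).2
    refine hpE ⟨β, ?_, ?_⟩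
    · refine mem_coe.2 (Fintype.mem_piFinset.2 fun s => ?_)
      by_cases hs : s = 0
      · simp [β, hs, h0]
      · have h1 := hp s.castSucc
        have h2 := hlab' s.castSucc (fun h => hs (Fin.ext h)) (by simp only [Fin.val_castSucc]; omega)
        rw [stackLabels, if_neg (by grind), mem_sigma, h2] at h1
        simpa [β, hs] using h1.2
    · funext s
      by_cases hs : s.1 = 0 ∨ s.1 = d + 1
      · have h1 := hp s
        rw [stackLabels, if_pos hs, mem_singleton] at h1
        exact (hE0 β s hs).trans h1.symm
      · refine (hE β s (by omega) (by omega)).trans ?_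
        refine Sigma.ext (hlab' s (by omega) (by omega)).symm (heq_of_eq ?_)
        exact if_neg (by grind)
  · intro β hβ
    rw [Fin.prod_univ_castSucc (n := d)]
    have hl : stackCore d g (Fin.last d) (E β (Fin.last d).castSucc) (x (Fin.last d))
        (E β (Fin.last d).succ) = 1 := by
      rw [stackCore, if_pos (Fin.val_last d), hE _ _ (by simp; omega) (by simp), if_pos]
      rw [Fin.val_last, hx]
    rw [hl, mul_one]
    refine prod_congr rfl fun j _ => ?_
    have hj := j.2
    rw [stackCore, if_neg (by simp; omega), hE β j.castSucc.succ (by simp) (by simp)]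
    by_cases h : j.1 = 0
    · have hj0 : j.castSucc = 0 := Fin.ext h
      rw [if_pos (by simpa using h), show β j.castSucc = 0 by rw [hj0, hzero β hβ]]
      simp only [h, Fin.val_castSucc]
      rfl
    · rw [if_neg (by simpa using h), hE β j.castSucc.castSucc (by simpa using h) (by simp),
        if_pos rfl]
      rfl

/-- **TT stacking along a new dimension.** If each slice `Xs k` admits a
TT representation with ranks `r k`, then the stacked `(d+1)`-dimensional tensor `X`,
with `X(i₁,…,i_d,k) = Xs k (i₁,…,i_d)`, admits a TT representation with ranks
`R 0 = R (d+1) = 1`, `R s = Σ_k (r k) s` for `1 ≤ s ≤ d − 1`, and `R d = l`. -/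
theorem tt_stack {d l : ℕ} (hd : 1 ≤ d) {n : Fin d → ℕ}
    (Xs : Fin l → (((j : Fin d) → Fin (n j)) → ℝ))
    (r : Fin l → (Fin (d + 1) → ℕ))
    (hXs : ∀ k : Fin l, isTT (r k) (Xs k))
    (X : ((j : Fin (d + 1)) → Fin (Fin.snoc (α := fun _ => ℕ) n l j)) → ℝ)
    (hX : ∀ (t : (j : Fin d) → Fin (n j)) (k : Fin l), X (sidx t k) = Xs k t) :
    ∃ R : Fin (d + 2) → ℕ, isTT R X ∧
      (∀ s : Fin (d + 2), (h1 : 1 ≤ s.1) → (h2 : s.1 ≤ d - 1) →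
        R s = ∑ k : Fin l, r k ⟨s.1, by omega⟩) ∧
      R ⟨d, by omega⟩ = l := by
  choose g hg using fun k => (hXs k).exists_nat_cores
  let ρ : ℕ → ℕ → ℕ := fun k s => if h : k < l ∧ s < d + 1 then r ⟨k, h.1⟩ ⟨s, h.2⟩ else 0
  let g' : ℕ → ℕ → ℕ → ℕ → ℕ → ℝ := fun k => if h : k < l then g ⟨k, h⟩ else 0
  have hρ : ∀ (k : Fin l) (s : Fin (d + 1)), ρ k s = r k s := fun k s => dif_pos ⟨k.2, s.2⟩
  have hg' : ∀ k : Fin l, g' k = g k := fun k => dif_pos k.2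
  have hcard : ∀ s : ℕ, s ≠ 0 → (hs : s < d + 1) →
      (stackLabels d l ρ s).card = ∑ k : Fin l, r k ⟨s, hs⟩ := by
    intro s h0 hs
    rw [stackLabels, if_neg (by omega), Finset.card_sigma, ← Fin.sum_univ_eq_sum_range
      (fun k => (Finset.range (ρ k s)).card)]
    exact Finset.sum_congr rfl fun k _ => by rw [Finset.card_range, ← hρ]
  refine ⟨fun s => (stackLabels d l ρ s).card, ?_, fun s h1 h2 => hcard s (by omega) _, ?_⟩
  · refine isTT_of_piFinset (by simp [stackLabels]) (by simp [stackLabels]) _ (fun _ => rfl)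
      (stackCore d g') fun i => ?_
    let t : (j : Fin d) → Fin (n j) := fun j =>
      Fin.cast (Fin.snoc_castSucc (α := fun _ => ℕ) l n j) (i j.castSucc)
    let k : Fin l := Fin.cast (Fin.snoc_last (α := fun _ => ℕ) l n) (i (Fin.last d))
    have hi : sidx t k = i := by
      funext j
      refine Fin.lastCases ?_ (fun j => ?_) j
      · simp [sidx, k]
      · simp [sidx, t]
    let x : ℕ → ℕ := fun j => if h : j < d + 1 then i ⟨j, h⟩ else 0
    have hx : ∀ j : Fin (d + 1), x j = i j := fun j => dif_pos j.2
    have key := sum_prod_stackCore hd k.2 ρ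
      ((hρ k 0).trans (hXs k).1) g' x (hx (Fin.last d))
    simp only [hx] at key
    rw [← key, ← hi, hX, hg, hg']
    simp only [hρ]
    refine Finset.sum_congr rfl fun p _ => Finset.prod_congr rfl fun j _ => ?_
    rw [show x j = t j from hx j.castSucc]
  · refine (hcard d (by omega) (by omega)).trans ?_
    refine (Finset.sum_congr rfl fun k _ => (hXs k).2.1).trans ?_
    simp
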